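/- The SPRCN-representable real numbers are closed under addition: if x and y are SPRCN-representable real numbers, then x + y is SPRCN-representable. -/

import Mathlib

open Filter

def SPRCNRep (x : ℝ) : Prop :=
  ∃ (I : ℤ) (P : ℕ → ℤ), Primrec P ∧ (∀ i, P i = -1 ∨ P i = 0 ∨ P i = 1) ∧
    Tendsto (fun n => (I : ℝ) + ∑ i ∈ Finset.Icc 1 n, (P i : ℝ) / 2 ^ i)
      atTop (nhds x)

/-- The carry out of a position with digit sum `s`, where `t` is the next digit sum to the right. -/
def signedCarry (s t : ℤ) : ℤ :=
  if s = 2 then 1 else if s = -2 then -1 else if s = 1 then (if 0 ≤ t then 1 else 0)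
  else if s = -1 then (if 0 ≤ t then 0 else -1) else 0

/-- The digit left over after carries, for three consecutive digit sums. -/
def signedAddDigit (s t u : ℤ) : ℤ := s - 2 * signedCarry s t + signedCarry t u

lemma signedCarry_mem {s t : ℤ} : -1 ≤ signedCarry s t ∧ signedCarry s t ≤ 1 := by
  unfold signedCarry
  split_ifs <;> omega

lemma signedAddDigit_mem {s t u : ℤ} (hs : -2 ≤ s ∧ s ≤ 2) :
    signedAddDigit s t u = -1 ∨ signedAddDigit s t u = 0 ∨ signedAddDigit s t u = 1 := by
  unfold signedAddDigit signedCarry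
  split_ifs <;> omega

/-- The signed digit coded by an element of `Fin 3`. -/
def signedDigit (a : Fin 3) : ℤ := (a : ℤ) - 1

lemma exists_primrec_signedDigit {P : ℕ → ℤ} (hP : Primrec P)
    (h : ∀ i, P i = -1 ∨ P i = 0 ∨ P i = 1) :
    ∃ d : ℕ → Fin 3, Primrec d ∧ ∀ i, P i = signedDigit (d i) := by
  refine ⟨fun i => if P i = -1 then 0 else if P i = 0 then 1 else 2, ?_, fun i => ?_⟩
  · exact Primrec.ite (Primrec.eq.comp hP (Primrec.const _)) (Primrec.const _)
      (Primrec.ite (Primrec.eq.comp hP (Primrec.const _)) (Primrec.const _) (Primrec.const _))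
  · rcases h i with h | h | h <;> simp [h, signedDigit]

lemma primrec_signedAddDigit {P Q : ℕ → ℤ} (hP : Primrec P) (hQ : Primrec Q)
    (hP' : ∀ i, P i = -1 ∨ P i = 0 ∨ P i = 1) (hQ' : ∀ i, Q i = -1 ∨ Q i = 0 ∨ Q i = 1) :
    Primrec fun i => signedAddDigit (P i + Q i) (P (i + 1) + Q (i + 1))
      (P (i + 2) + Q (i + 2)) := by
  obtain ⟨d, hd, hPd⟩ := exists_primrec_signedDigit hP hP'
  obtain ⟨e, he, hQe⟩ := exists_primrec_signedDigit hQ hQ'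
  have hde : Primrec fun i => (d i, e i) := hd.pair he
  have h₁ : Primrec fun i => (d (i + 1), e (i + 1)) := hde.comp Primrec.succ
  have h₂ : Primrec fun i => (d (i + 2), e (i + 2)) := h₁.comp Primrec.succ
  have hF : Primrec fun v : (Fin 3 × Fin 3) × (Fin 3 × Fin 3) × (Fin 3 × Fin 3) =>
      signedAddDigit (signedDigit v.1.1 + signedDigit v.1.2)
        (signedDigit v.2.1.1 + signedDigit v.2.1.2)
        (signedDigit v.2.2.1 + signedDigit v.2.2.2) := Primrec.dom_finite _
  exact (hF.comp (hde.pair (h₁.pair h₂))).of_eq fun i => by simp only [hPd, hQe]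

lemma sum_signedAddDigit (s : ℕ → ℤ) (n : ℕ) :
    (signedCarry (s 1) (s 2) : ℝ) +
        ∑ i ∈ Finset.Icc 1 n, (signedAddDigit (s i) (s (i + 1)) (s (i + 2)) : ℝ) / 2 ^ i =
      ∑ i ∈ Finset.Icc 1 n, (s i : ℝ) / 2 ^ i +
        (signedCarry (s (n + 1)) (s (n + 2)) : ℝ) / 2 ^ n := by
  induction n with
  | zero => simp
  | succ n ih =>
    rw [Finset.sum_Icc_succ_top (by omega), Finset.sum_Icc_succ_top (by omega), ← add_assoc, ih]
    simp only [signedAddDigit, pow_succ]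
    push_cast
    field_simp
    ring

lemma tendsto_signedCarry_div (s : ℕ → ℤ) :
    Tendsto (fun n => (signedCarry (s (n + 1)) (s (n + 2)) : ℝ) / 2 ^ n) atTop (nhds 0) := by
  refine squeeze_zero_norm (a := fun n : ℕ => (1 / 2 : ℝ) ^ n) (fun n => ?_)
    (tendsto_pow_atTop_nhds_zero_of_lt_one (by norm_num) (by norm_num))
  have h : |(signedCarry (s (n + 1)) (s (n + 2)) : ℝ)| ≤ 1 := by
    exact_mod_cast abs_le.2 (signedCarry_mem (s := s (n + 1)) (t := s (n + 2)))
  rw [norm_div, norm_pow, Real.norm_eq_abs, Real.norm_two, one_div_pow]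
  gcongr

theorem stmt_7 (x y : ℝ) (hx : SPRCNRep x) (hy : SPRCNRep y) :
    SPRCNRep (x + y) := by
  obtain ⟨I, P, hP, hP', hPx⟩ := hx
  obtain ⟨J, Q, hQ, hQ', hQy⟩ := hy
  let s : ℕ → ℤ := fun i => P i + Q i
  refine ⟨I + J + signedCarry (s 1) (s 2),
    fun i => signedAddDigit (s i) (s (i + 1)) (s (i + 2)),
    primrec_signedAddDigit hP hQ hP' hQ', fun i => signedAddDigit_mem ?_, ?_⟩
  · have := hP' i
    have := hQ' i
    simp only [s]
    omega
  · have h := (hPx.add hQy).add (tendsto_signedCarry_div s)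
    rw [add_zero] at h
    refine h.congr fun n => ?_
    have hs : ∑ i ∈ Finset.Icc 1 n, (s i : ℝ) / 2 ^ i =
        ∑ i ∈ Finset.Icc 1 n, (P i : ℝ) / 2 ^ i + ∑ i ∈ Finset.Icc 1 n, (Q i : ℝ) / 2 ^ i := by
      simp only [s, Int.cast_add, add_div, Finset.sum_add_distrib]
    have := sum_signedAddDigit s n
    push_cast
    linarith
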